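/- For all linearly independent vectors a, b in H, the function f : [0,1] → ℝ defined by f(q) = ω_q(a⊗b) is strictly concave on [0,1]; that is, for all q₁, q₂ ∈ [0,1] with q₁ ≠ q₂ and all t ∈ (0,1), f(t·q₁ + (1−t)·q₂) > t·f(q₁) + (1−t)·f(q₂). -/

import Mathlib

open scoped ComplexInnerProductSpace

/-- The rank-one operator `a ⊗ b` on a complex Hilbert space, acting by
`(a ⊗ b) x = ⟨x, a⟩ · b` (i.e. `x ↦ ⟪a, x⟫ • b` in Mathlib's convention, where the
inner product is conjugate-linear in the first slot). -/
noncomputable def rankOne {H : Type*} [NormedAddCommGroup H] [InnerProductSpace ℂ H]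
    (a b : H) : H →L[ℂ] H :=
  (innerSL ℂ a).smulRight b

/-- The `q`-numerical radius `ω_q(A) = sup { |⟨Ax, y⟩| : ‖x‖ = ‖y‖ = 1, ⟨x, y⟩ = q }`. -/
noncomputable def qRad {H : Type*} [NormedAddCommGroup H] [InnerProductSpace ℂ H]
    (q : ℝ) (A : H →L[ℂ] H) : ℝ :=
  sSup {r : ℝ | ∃ x y : H, ‖x‖ = 1 ∧ ‖y‖ = 1 ∧ ⟪x, y⟫ = (q : ℂ) ∧ r = ‖⟪A x, y⟫‖}

section

variable {H : Type*} [NormedAddCommGroup H] [InnerProductSpace ℂ H]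

lemma norm_inner_le_one {x y : H} (hx : ‖x‖ = 1) (hy : ‖y‖ = 1) : ‖⟪x, y⟫‖ ≤ 1 := by
  simpa [hx, hy] using norm_inner_le_norm (𝕜 := ℂ) x y

lemma norm_sub_inner_smul_sq {x y : H} (hx : ‖x‖ = 1) (hy : ‖y‖ = 1) :
    ‖x - ⟪y, x⟫ • y‖ ^ 2 = 1 - ‖⟪y, x⟫‖ ^ 2 := by
  have h := norm_sub_sq (𝕜 := ℂ) x (⟪y, x⟫ • y)
  rw [inner_smul_right, ← inner_conj_symm x y, RCLike.mul_conj, norm_smul, hx, hy] at h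
  norm_cast at h
  push_cast at h
  linarith

/-- The triangle inequality for the Fubini-Study angle between unit vectors. -/
lemma arccos_norm_inner_le_add {x y z : H} (hx : ‖x‖ = 1) (hy : ‖y‖ = 1) (hz : ‖z‖ = 1) :
    Real.arccos ‖⟪x, z⟫‖ ≤ Real.arccos ‖⟪x, y⟫‖ + Real.arccos ‖⟪y, z⟫‖ := by
  have hcs := norm_inner_le_norm (𝕜 := ℂ) (x - ⟪y, x⟫ • y) (z - ⟪y, z⟫ • y)
  have hinner : ⟪x - ⟪y, x⟫ • y, z - ⟪y, z⟫ • y⟫ = ⟪x, z⟫ - ⟪x, y⟫ * ⟪y, z⟫ := by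
    have hyy : ⟪y, y⟫ = 1 := by simp [inner_self_eq_norm_sq_to_K, hy]
    simp only [inner_sub_left, inner_sub_right, inner_smul_left, inner_smul_right,
      inner_conj_symm, hyy]
    ring
  have hnx : ‖x - ⟪y, x⟫ • y‖ = √(1 - ‖⟪x, y⟫‖ ^ 2) := by
    rw [norm_inner_symm x y, ← norm_sub_inner_smul_sq hx hy, Real.sqrt_sq (norm_nonneg _)]
  have hnz : ‖z - ⟪y, z⟫ • y‖ = √(1 - ‖⟪y, z⟫‖ ^ 2) := by
    rw [← norm_sub_inner_smul_sq hz hy, Real.sqrt_sq (norm_nonneg _)]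
  rw [hinner, hnx, hnz] at hcs
  have htri := norm_sub_norm_le (⟪x, y⟫ * ⟪y, z⟫) ⟪x, z⟫
  rw [norm_sub_rev, norm_mul] at htri
  rcases le_total (Real.arccos ‖⟪x, y⟫‖ + Real.arccos ‖⟪y, z⟫‖) Real.pi with hpi | hpi
  · rw [← Real.arccos_cos (add_nonneg (Real.arccos_nonneg _) (Real.arccos_nonneg _)) hpi]
    apply Real.arccos_le_arccos
    rw [Real.cos_add, Real.sin_arccos, Real.sin_arccos,
      Real.cos_arccos (by linarith [norm_nonneg ⟪x, y⟫]) (norm_inner_le_one hx hy),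
      Real.cos_arccos (by linarith [norm_nonneg ⟪y, z⟫]) (norm_inner_le_one hy hz)]
    linarith
  · exact (Real.arccos_le_pi _).trans hpi

/-- For unit vectors, the product of the cosines of the angles `∠(a, x)` and `∠(b, y)` is
controlled by the difference of the angles `∠(x, y)` and `∠(a, b)`. -/
lemma norm_inner_mul_norm_inner_le {a b x y : H} (ha : ‖a‖ = 1) (hb : ‖b‖ = 1)
    (hx : ‖x‖ = 1) (hy : ‖y‖ = 1) :
    ‖⟪a, x⟫‖ * ‖⟪b, y⟫‖ ≤
      (1 + Real.cos (Real.arccos ‖⟪a, b⟫‖ - Real.arccos ‖⟪x, y⟫‖)) / 2 := by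
  have h₁ := arccos_norm_inner_le_add hx ha hy
  have h₂ := arccos_norm_inner_le_add ha hb hy
  have h₃ := arccos_norm_inner_le_add ha hx hb
  have h₄ := arccos_norm_inner_le_add hx hy hb
  rw [norm_inner_symm x a] at h₁
  rw [norm_inner_symm y b] at h₄
  have hu := Real.cos_arccos (by linarith [norm_nonneg ⟪a, x⟫]) (norm_inner_le_one ha hx)
  have hv := Real.cos_arccos (by linarith [norm_nonneg ⟪b, y⟫]) (norm_inner_le_one hb hy)
  have hu' := Real.arccos_le_pi_div_two.2 (norm_nonneg ⟪a, x⟫)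
  have hv' := Real.arccos_le_pi_div_two.2 (norm_nonneg ⟪b, y⟫)
  set u := Real.arccos ‖⟪a, x⟫‖
  set v := Real.arccos ‖⟪b, y⟫‖
  set γ := Real.arccos ‖⟪a, b⟫‖
  set θ := Real.arccos ‖⟪x, y⟫‖
  have hcos : Real.cos (u + v) ≤ Real.cos (γ - θ) := by
    rw [← Real.cos_abs (γ - θ)]
    apply Real.cos_le_cos_of_nonneg_of_le_pi (abs_nonneg _) (by linarith)
    rw [abs_le]
    constructor <;> linarith
  rw [← hu, ← hv]
  have h := Real.cos_le_one (u - v)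
  rw [Real.cos_sub] at h
  rw [Real.cos_add] at hcos
  linarith

lemma inner_cos_smul_add_sin_smul {e f : H} (he : ‖e‖ = 1) (hf : ‖f‖ = 1) (hef : ⟪e, f⟫ = 0)
    (α β : ℝ) :
    ⟪(Real.cos α : ℂ) • e + (Real.sin α : ℂ) • f, (Real.cos β : ℂ) • e + (Real.sin β : ℂ) • f⟫ =
      (Real.cos (α - β) : ℂ) := by
  have hfe : ⟪f, e⟫ = 0 := inner_eq_zero_symm.1 hef
  have hee : ⟪e, e⟫ = 1 := by simp [inner_self_eq_norm_sq_to_K, he]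
  have hff : ⟪f, f⟫ = 1 := by simp [inner_self_eq_norm_sq_to_K, hf]
  simp only [inner_add_left, inner_add_right, inner_smul_left, inner_smul_right, hef, hfe, hee,
    hff, Complex.conj_ofReal, Real.cos_sub]
  push_cast
  ring

/-- Two unit vectors that span different lines lie, up to a phase, on a common great circle. -/
lemma exists_orthonormal_eq_cos_add_sin {a b : H} (ha : ‖a‖ = 1) (hb : ‖b‖ = 1)
    (hc : ‖⟪a, b⟫‖ < 1) :
    ∃ (f : H) (μ : ℂ), ‖f‖ = 1 ∧ ⟪a, f⟫ = 0 ∧ ‖μ‖ = 1 ∧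
      μ • b = (Real.cos (Real.arccos ‖⟪a, b⟫‖) : ℂ) • a +
        (Real.sin (Real.arccos ‖⟪a, b⟫‖) : ℂ) • f := by
  obtain ⟨μ, hμ, hμc⟩ : ∃ μ : ℂ, ‖μ‖ = 1 ∧ (‖⟪a, b⟫‖ : ℂ) = μ * ⟪a, b⟫ :=
    RCLike.exists_norm_eq_mul_self _
  have hs : 0 < 1 - ‖⟪a, b⟫‖ ^ 2 := by nlinarith [norm_nonneg ⟪a, b⟫]
  have hs' : (√(1 - ‖⟪a, b⟫‖ ^ 2) : ℂ) ≠ 0 := by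
    exact_mod_cast (Real.sqrt_pos.2 hs).ne'
  have hμb : ‖μ • b‖ = 1 := by rw [norm_smul, hμ, hb, one_mul]
  have hin : ⟪a, μ • b⟫ = (‖⟪a, b⟫‖ : ℂ) := by rw [inner_smul_right, hμc]
  have hn := norm_sub_inner_smul_sq hμb ha
  rw [hin] at hn
  rw [Real.cos_arccos (by linarith [norm_nonneg ⟪a, b⟫]) hc.le, Real.sin_arccos]
  refine ⟨(√(1 - ‖⟪a, b⟫‖ ^ 2) : ℂ)⁻¹ • (μ • b - (‖⟪a, b⟫‖ : ℂ) • a), μ, ?_, ?_, hμ, ?_⟩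
  · rw [Complex.norm_real, norm_norm] at hn
    rw [norm_smul, norm_inv, Complex.norm_real, Real.norm_of_nonneg (Real.sqrt_nonneg _), ← hn,
      Real.sqrt_sq (norm_nonneg _), inv_mul_cancel₀]
    intro h
    rw [h] at hn
    simp [← hn] at hs
  · have haa : ⟪a, a⟫ = 1 := by simp [inner_self_eq_norm_sq_to_K, ha]
    rw [inner_smul_right, inner_sub_right, hin, inner_smul_right, haa]
    simp
  · rw [smul_inv_smul₀ hs']
    abel

lemma exists_inner_eq_norm_inner_mul_eq {a b : H} (ha : ‖a‖ = 1) (hb : ‖b‖ = 1)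
    (hc : ‖⟪a, b⟫‖ < 1) {q : ℝ} (hq : q ∈ Set.Icc (0 : ℝ) 1) :
    ∃ x y : H, ‖x‖ = 1 ∧ ‖y‖ = 1 ∧ ⟪x, y⟫ = (q : ℂ) ∧
      ‖⟪a, x⟫‖ * ‖⟪b, y⟫‖ =
        (1 + Real.cos (Real.arccos ‖⟪a, b⟫‖ - Real.arccos q)) / 2 := by
  obtain ⟨f, μ, hf, haf, hμ, hμb⟩ := exists_orthonormal_eq_cos_add_sin ha hb hc
  set γ := Real.arccos ‖⟪a, b⟫‖
  set θ := Real.arccos q with hθ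
  have hin := inner_cos_smul_add_sin_smul ha hf haf
  have hnorm (α : ℝ) : ‖(Real.cos α : ℂ) • a + (Real.sin α : ℂ) • f‖ = 1 := by
    rw [← pow_eq_one_iff_of_nonneg (norm_nonneg _) two_ne_zero, ← inner_self_eq_norm_sq (𝕜 := ℂ),
      hin, sub_self, Real.cos_zero]
    simp
  refine ⟨_, _, hnorm ((γ - θ) / 2), hnorm ((γ - θ) / 2 + θ), ?_, ?_⟩
  · rw [hin, sub_add_cancel_left, Real.cos_neg, hθ, Real.cos_arccos (by linarith [hq.1]) hq.2]
  · have h₁ := hin 0 ((γ - θ) / 2)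
    have h₂ := hin γ ((γ - θ) / 2 + θ)
    rw [← hμb, inner_smul_left] at h₂
    have h₂' := congrArg norm h₂
    rw [norm_mul, RCLike.norm_conj, hμ, one_mul] at h₂'
    simp only [Real.cos_zero, Real.sin_zero, Complex.ofReal_one, Complex.ofReal_zero, one_smul,
      zero_smul, add_zero, zero_sub, Real.cos_neg] at h₁
    rw [h₁, h₂', Complex.norm_real, Complex.norm_real, show γ - ((γ - θ) / 2 + θ) = (γ - θ) / 2 by
      ring, Real.norm_eq_abs, abs_mul_abs_self, ← sq, Real.cos_sq]
    ring_nf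

lemma norm_inner_rankOne_apply (a b x y : H) :
    ‖⟪rankOne a b x, y⟫‖ = ‖⟪a, x⟫‖ * ‖⟪b, y⟫‖ := by
  simp [rankOne, norm_inner_symm x a, mul_comm]

lemma qRad_rankOne {a b : H} (ha : ‖a‖ = 1) (hb : ‖b‖ = 1) (hc : ‖⟪a, b⟫‖ < 1) {q : ℝ}
    (hq : q ∈ Set.Icc (0 : ℝ) 1) :
    qRad q (rankOne a b) =
      (1 + ‖⟪a, b⟫‖ * q + √(1 - ‖⟪a, b⟫‖ ^ 2) * √(1 - q ^ 2)) / 2 := by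
  have hcos : 1 + ‖⟪a, b⟫‖ * q + √(1 - ‖⟪a, b⟫‖ ^ 2) * √(1 - q ^ 2) =
      1 + Real.cos (Real.arccos ‖⟪a, b⟫‖ - Real.arccos q) := by
    rw [Real.cos_sub, Real.cos_arccos (by linarith [norm_nonneg ⟪a, b⟫]) hc.le,
      Real.cos_arccos (by linarith [hq.1]) hq.2, Real.sin_arccos, Real.sin_arccos, add_assoc]
  rw [hcos]
  refine IsGreatest.csSup_eq ⟨?_, ?_⟩
  · obtain ⟨x, y, hx, hy, hxy, h⟩ := exists_inner_eq_norm_inner_mul_eq ha hb hc hq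
    exact ⟨x, y, hx, hy, hxy, by rw [norm_inner_rankOne_apply, h]⟩
  · rintro _ ⟨x, y, hx, hy, hxy, rfl⟩
    have h := norm_inner_mul_norm_inner_le ha hb hx hy
    rwa [hxy, Complex.norm_real, Real.norm_of_nonneg hq.1, ← norm_inner_rankOne_apply] at h

lemma qRad_smul (q : ℝ) {c : ℝ} (hc : 0 ≤ c) (A : H →L[ℂ] H) :
    qRad q ((c : ℂ) • A) = c * qRad q A := by
  rw [qRad, qRad, ← smul_eq_mul, ← Real.sSup_smul_of_nonneg hc]
  congr 1
  ext r
  simp only [Set.mem_smul_set, Set.mem_ofPred_eq, smul_eq_mul]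
  have h (x y : H) : ‖⟪((c : ℂ) • A) x, y⟫‖ = c * ‖⟪A x, y⟫‖ := by
    simp [abs_of_nonneg hc]
  constructor
  · rintro ⟨x, y, hx, hy, hxy, rfl⟩
    exact ⟨_, ⟨x, y, hx, hy, hxy, rfl⟩, (h x y).symm⟩
  · rintro ⟨_, ⟨x, y, hx, hy, hxy, rfl⟩, rfl⟩
    exact ⟨x, y, hx, hy, hxy, (h x y).symm⟩

lemma rankOne_eq_smul_rankOne_normalize {a b : H} (ha : a ≠ 0) (hb : b ≠ 0) :
    rankOne a b = ((‖a‖ * ‖b‖ : ℝ) : ℂ) •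
      rankOne ((‖a‖⁻¹ : ℂ) • a) ((‖b‖⁻¹ : ℂ) • b) := by
  ext x
  have ha' : (‖a‖ : ℂ) ≠ 0 := by simpa using ha
  have hb' : (‖b‖ : ℂ) ≠ 0 := by simpa using hb
  simp only [rankOne, ContinuousLinearMap.smulRight_apply, innerSL_apply_apply,
    smul_apply, inner_smul_left, smul_smul, map_inv₀, Complex.conj_ofReal]
  congr 1
  push_cast
  field_simp

end

lemma strictConcaveOn_sqrt_one_sub_sq :
    StrictConcaveOn ℝ (Set.Icc (0 : ℝ) 1) fun q ↦ √(1 - q ^ 2) := by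
  refine ⟨convex_Icc 0 1, fun p hp r hr hne s t hs ht hst ↦ ?_⟩
  obtain rfl : t = 1 - s := by linarith
  simp only [smul_eq_mul]
  have hu := Real.sq_sqrt (show 0 ≤ 1 - p ^ 2 by nlinarith [hp.1, hp.2])
  have hv := Real.sq_sqrt (show 0 ≤ 1 - r ^ 2 by nlinarith [hr.1, hr.2])
  set u := √(1 - p ^ 2)
  set v := √(1 - r ^ 2)
  apply Real.lt_sqrt_of_sq_lt
  have hpr : 0 < (p - r) ^ 2 := by
    have := sub_ne_zero.2 hne
    positivity
  have h : 0 < s * (1 - s) * ((p - r) ^ 2 + (u - v) ^ 2) := by positivity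
  linear_combination h + s * hu + (1 - s) * hv

/-- For linearly independent `a`, `b`, the function `q ↦ ω_q(a ⊗ b)` is strictly
concave on `[0, 1]`. -/
theorem stmt8 {H : Type*} [NormedAddCommGroup H] [InnerProductSpace ℂ H] [CompleteSpace H]
    (hdim : 2 ≤ Module.rank ℂ H) (a b : H) (hab : LinearIndependent ℂ ![a, b])
    (q₁ q₂ : ℝ) (hq₁ : q₁ ∈ Set.Icc (0 : ℝ) 1) (hq₂ : q₂ ∈ Set.Icc (0 : ℝ) 1)
    (hne : q₁ ≠ q₂) (t : ℝ) (ht : t ∈ Set.Ioo (0 : ℝ) 1) :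
    qRad (t * q₁ + (1 - t) * q₂) (rankOne a b) >
      t * qRad q₁ (rankOne a b) + (1 - t) * qRad q₂ (rankOne a b) := by
  have ha : a ≠ 0 := hab.ne_zero 0
  have hb : b ≠ 0 := hab.ne_zero 1
  have hN : 0 < ‖a‖ * ‖b‖ := mul_pos (norm_pos_iff.2 ha) (norm_pos_iff.2 hb)
  have hc : ‖⟪(‖a‖⁻¹ : ℂ) • a, (‖b‖⁻¹ : ℂ) • b⟫‖ < 1 := by
    have hlt : ‖⟪a, b⟫‖ < ‖a‖ * ‖b‖ := by
      refine (norm_inner_le_norm a b).lt_of_ne fun h ↦ ?_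
      obtain ⟨r, -, rfl⟩ := (norm_inner_eq_norm_iff ha hb).1 h
      exact (LinearIndependent.pair_iff' ha).1 hab r rfl
    rw [inner_smul_left, inner_smul_right, norm_mul, norm_mul, RCLike.norm_conj, norm_inv,
      norm_inv, Complex.norm_real, Complex.norm_real, norm_norm, norm_norm, ← mul_assoc,
      ← mul_inv, inv_mul_lt_one₀ hN]
    exact hlt
  have hq := convex_Icc (0 : ℝ) 1 hq₁ hq₂ ht.1.le (sub_nonneg.2 ht.2.le) (by ring)
  have hconc := strictConcaveOn_sqrt_one_sub_sq.2 hq₁ hq₂ hne ht.1 (sub_pos.2 ht.2) (by ring)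
  simp only [smul_eq_mul] at hq hconc
  have ha' : ‖(‖a‖⁻¹ : ℂ) • a‖ = 1 := norm_smul_inv_norm ha
  have hb' : ‖(‖b‖⁻¹ : ℂ) • b‖ = 1 := norm_smul_inv_norm hb
  rw [rankOne_eq_smul_rankOne_normalize ha hb]
  simp only [qRad_smul _ hN.le]
  rw [qRad_rankOne ha' hb' hc hq, qRad_rankOne ha' hb' hc hq₁, qRad_rankOne ha' hb' hc hq₂]
  set c := ‖⟪(‖a‖⁻¹ : ℂ) • a, (‖b‖⁻¹ : ℂ) • b⟫‖
  have hs : 0 < √(1 - c ^ 2) :=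
    Real.sqrt_pos.2 (by nlinarith [norm_nonneg ⟪(‖a‖⁻¹ : ℂ) • a, (‖b‖⁻¹ : ℂ) • b⟫])
  linear_combination (‖a‖ * ‖b‖ / 2) * (√(1 - c ^ 2) * hconc)
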